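/- arXiv:2401.04847 — 2 statements merged into one kernel-verified Lean document; each statement's English description precedes it below -/
import Mathlib

section
/- Suppose b ∈ Cf_g(X), i.e., b minimizes y ↦ Σ_{x∈X} ℓ(g(x), y) over ℝ. If X is a maximal upper set and the empty set is a minimal lower set with respect to b, or conversely X is a minimal lower set and the empty set is a maximal upper set with respect to b, then the constant function x ↦ b is isotonic and minimizes J_X(g, ·) over I_X. -/
open Pointwise Finset
open scoped Classical

variable {X : Type*}

/-- `f` is isotonic on the subset `S` of `X`. -/
def IsotonicOn [PartialOrder X] (f : X → ℝ) (S : Finset X) : Prop :=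
  ∀ x ∈ S, ∀ y ∈ S, x ≤ y → f x ≤ f y

/-- The separable loss `J_S(g, f) = Σ_{x∈S} ℓ(g(x), f(x))`. -/
noncomputable def lossJ (ℓ : ℝ → ℝ → ℝ) (g : X → ℝ) (S : Finset X) (f : X → ℝ) : ℝ :=
  ∑ x ∈ S, ℓ (g x) (f x)

/-- The subdifferential of the convex function `ℓ(a, ·)` at `b`. -/
def subdiff (ℓ : ℝ → ℝ → ℝ) (a b : ℝ) : Set ℝ :=
  {s : ℝ | ∀ y : ℝ, ℓ a b + s * (y - b) ≤ ℓ a y}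

/-- `Σ_b(S) = −Σ_{x∈S} ∂ℓ(g(x), b)` (Minkowski sum; `Σ_b(∅) = {0}`). -/
noncomputable def SigmaSet (ℓ : ℝ → ℝ → ℝ) (g : X → ℝ) (b : ℝ) (S : Finset X) : Set ℝ :=
  -∑ x ∈ S, subdiff ℓ (g x) b

/-- `U` is an upper set of `X`. -/
def IsUpperFinset [PartialOrder X] (U : Finset X) : Prop :=
  ∀ x ∈ U, ∀ y : X, x ≤ y → y ∈ U

/-- `L` is a lower set of `X`. -/
def IsLowerFinset [PartialOrder X] (L : Finset X) : Prop :=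
  ∀ y ∈ L, ∀ x : X, x ≤ y → x ∈ L

/-- `U` is a maximal upper set with respect to `b`:
it maximizes `min Σ_b(U')` over all upper sets `U'`. -/
def IsMaxUpper [PartialOrder X] (ℓ : ℝ → ℝ → ℝ) (g : X → ℝ) (b : ℝ) (U : Finset X) : Prop :=
  IsUpperFinset U ∧ ∀ U' : Finset X, IsUpperFinset U' →
    sInf (SigmaSet ℓ g b U') ≤ sInf (SigmaSet ℓ g b U)

/-- `L` is a minimal lower set with respect to `b`:
it minimizes `max Σ_b(L')` over all lower sets `L'`. -/
def IsMinLower [PartialOrder X] (ℓ : ℝ → ℝ → ℝ) (g : X → ℝ) (b : ℝ) (L : Finset X) : Prop :=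
  IsLowerFinset L ∧ ∀ L' : Finset X, IsLowerFinset L' →
    sSup (SigmaSet ℓ g b L) ≤ sSup (SigmaSet ℓ g b L')

/-- A supporting slope at `b` is at most the right derivative. -/
lemma supporting_slope_le_rightDeriv {f : ℝ → ℝ} {b s f' : ℝ}
    (hs : ∀ y, f b + s * (y - b) ≤ f y) (hf : HasDerivWithinAt f f' (Set.Ioi b) b) : s ≤ f' := by
  refine ge_of_tendsto ((hasDerivWithinAt_iff_tendsto_slope' Set.self_notMem_Ioi).mp hf) ?_
  filter_upwards [self_mem_nhdsWithin] with y hy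
  rw [slope_def_field, le_div_iff₀ (sub_pos.mpr hy)]
  linarith [hs y]

/-- A supporting slope at `b` is at least the left derivative. -/
lemma leftDeriv_le_supporting_slope {f : ℝ → ℝ} {b s f' : ℝ}
    (hs : ∀ y, f b + s * (y - b) ≤ f y) (hf : HasDerivWithinAt f f' (Set.Iio b) b) : f' ≤ s := by
  refine le_of_tendsto ((hasDerivWithinAt_iff_tendsto_slope' Set.self_notMem_Iio).mp hf) ?_
  filter_upwards [self_mem_nhdsWithin] with y hy
  rw [slope_def_field, div_le_iff_of_neg (sub_neg.mpr hy)]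
  linarith [hs y]

/-- Every number between the one-sided derivatives of a convex function is a supporting slope. -/
lemma ConvexOn.supporting_slope_of_mem_Icc {f : ℝ → ℝ} (hf : ConvexOn ℝ Set.univ f) {b s : ℝ}
    (hs : s ∈ Set.Icc (derivWithin f (Set.Iio b) b) (derivWithin f (Set.Ioi b) b)) (y : ℝ) :
    f b + s * (y - b) ≤ f y := by
  have hb : b ∈ interior (Set.univ : Set ℝ) := by simp
  rcases lt_trichotomy y b with h | rfl | h
  · have h1 := (hf.slope_le_of_hasDerivWithinAt_Iio (Set.mem_univ y) (Set.mem_univ b) h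
      (hf.hasDerivWithinAt_leftDeriv_of_mem_interior hb)).trans hs.1
    rw [slope_def_field, div_le_iff₀ (sub_pos.mpr h)] at h1
    linarith
  · simp
  · have h1 := hs.2.trans (hf.le_slope_of_hasDerivWithinAt_Ioi (Set.mem_univ b) (Set.mem_univ y) h
      (hf.hasDerivWithinAt_rightDeriv_of_mem_interior hb))
    rw [slope_def_field, le_div_iff₀ (sub_pos.mpr h)] at h1
    linarith

/-- The subdifferential of a convex loss is the interval between its one-sided derivatives. -/
lemma subdiff_eq_Icc {ℓ : ℝ → ℝ → ℝ} {a : ℝ} (hf : ConvexOn ℝ Set.univ (ℓ a)) (b : ℝ) :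
    subdiff ℓ a b =
      Set.Icc (derivWithin (ℓ a) (Set.Iio b) b) (derivWithin (ℓ a) (Set.Ioi b) b) := by
  have hb : b ∈ interior (Set.univ : Set ℝ) := by simp
  ext s
  exact ⟨fun hs ↦
    ⟨leftDeriv_le_supporting_slope hs (hf.hasDerivWithinAt_leftDeriv_of_mem_interior hb),
      supporting_slope_le_rightDeriv hs (hf.hasDerivWithinAt_rightDeriv_of_mem_interior hb)⟩,
    fun hs ↦ hf.supporting_slope_of_mem_Icc hs⟩

lemma isGreatest_finset_sum {ι : Type*} {A : ι → Set ℝ} {r : ι → ℝ} (S : Finset ι)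
    (h : ∀ i ∈ S, IsGreatest (A i) (r i)) : IsGreatest (∑ i ∈ S, A i) (∑ i ∈ S, r i) := by
  refine ⟨Set.finsetSum_mem_finsetSum S A r fun i hi ↦ (h i hi).1, fun z hz ↦ ?_⟩
  obtain ⟨u, hu, rfl⟩ := (Set.mem_finsetSum S A z).mp hz
  exact Finset.sum_le_sum fun i hi ↦ (h i hi).2 (hu hi)

lemma isLeast_finset_sum {ι : Type*} {A : ι → Set ℝ} {r : ι → ℝ} (S : Finset ι)
    (h : ∀ i ∈ S, IsLeast (A i) (r i)) : IsLeast (∑ i ∈ S, A i) (∑ i ∈ S, r i) := by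
  refine ⟨Set.finsetSum_mem_finsetSum S A r fun i hi ↦ (h i hi).1, fun z hz ↦ ?_⟩
  obtain ⟨u, hu, rfl⟩ := (Set.mem_finsetSum S A z).mp hz
  exact Finset.sum_le_sum fun i hi ↦ (h i hi).2 (hu hi)

lemma sInf_SigmaSet {ℓ : ℝ → ℝ → ℝ} (hconv : ∀ a, ConvexOn ℝ Set.univ (ℓ a)) (g : X → ℝ) (b : ℝ)
    (S : Finset X) :
    sInf (SigmaSet ℓ g b S) = -∑ x ∈ S, derivWithin (ℓ (g x)) (Set.Ioi b) b := by
  have h : IsGreatest (∑ x ∈ S, subdiff ℓ (g x) b)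
      (∑ x ∈ S, derivWithin (ℓ (g x)) (Set.Ioi b) b) := by
    refine isGreatest_finset_sum S fun x _ ↦ ?_
    rw [subdiff_eq_Icc (hconv (g x))]
    exact isGreatest_Icc ((hconv (g x)).leftDeriv_le_rightDeriv_of_mem_interior (by simp))
  rw [SigmaSet, Real.sInf_def, neg_neg, h.csSup_eq]

lemma sSup_SigmaSet {ℓ : ℝ → ℝ → ℝ} (hconv : ∀ a, ConvexOn ℝ Set.univ (ℓ a)) (g : X → ℝ) (b : ℝ)
    (S : Finset X) :
    sSup (SigmaSet ℓ g b S) = -∑ x ∈ S, derivWithin (ℓ (g x)) (Set.Iio b) b := by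
  have h : IsLeast (∑ x ∈ S, subdiff ℓ (g x) b)
      (∑ x ∈ S, derivWithin (ℓ (g x)) (Set.Iio b) b) := by
    refine isLeast_finset_sum S fun x _ ↦ ?_
    rw [subdiff_eq_Icc (hconv (g x))]
    exact isLeast_Icc ((hconv (g x)).leftDeriv_le_rightDeriv_of_mem_interior (by simp))
  rw [SigmaSet, ← h.csInf_eq, Real.sInf_def, neg_neg]

/-- If the weights of every superlevel set of a nonnegative function have nonnegative sum, then
so does the weighted sum of the function. -/
lemma sum_mul_nonneg_of_superlevel [Fintype X] (w p : X → ℝ) (hp : ∀ x, 0 ≤ p x)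
    (hw : ∀ t, 0 ≤ t → 0 ≤ ∑ x with t < p x, w x) : 0 ≤ ∑ x, w x * p x := by
  induction hn : #{x | 0 < p x} using Nat.strong_induction_on generalizing p with
  | _ n ih =>
    rcases Finset.eq_empty_or_nonempty ({x | 0 < p x} : Finset X) with he | hne
    · have h0 : ∀ x, p x = 0 := fun x ↦
        le_antisymm (not_lt.mp (Finset.filter_eq_empty_iff.mp he (mem_univ x))) (hp x)
      simp [h0]
    · obtain ⟨x₀, hx₀, hmin⟩ := Finset.exists_min_image _ p hne
      have hm : 0 < p x₀ := by simpa using hx₀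
      replace hmin : ∀ x, 0 < p x → p x₀ ≤ p x := fun x hx ↦ hmin x (by simpa using hx)
      let q : X → ℝ := fun x ↦ max (p x - p x₀) 0
      have hq : ∀ x t, 0 ≤ t → (t < q x ↔ t + p x₀ < p x) := fun x t ht ↦ by
        simp only [q, lt_max_iff, not_lt.mpr ht, or_false, lt_sub_iff_add_lt]
      have hsplit : ∀ x, w x * p x = (if 0 < p x then w x else 0) * p x₀ + w x * q x := fun x ↦ by
        split_ifs with hx
        · rw [show q x = p x - p x₀ from max_eq_left (sub_nonneg.mpr (hmin x hx))]
          ring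
        · have hx0 : p x = 0 := le_antisymm (not_lt.mp hx) (hp x)
          rw [show q x = 0 from max_eq_right (by linarith), hx0]
          ring
      have hcard : #{x | 0 < q x} < n := by
        rw [← hn]
        refine Finset.card_lt_card (Finset.ssubset_iff_of_subset ?_ |>.mpr ⟨x₀, hx₀, ?_⟩)
        · intro x hx
          simp only [Finset.mem_filter_univ, hq x 0 le_rfl] at hx ⊢
          linarith
        · simp [q]
      have hqsum := ih _ hcard q (fun x ↦ le_max_right _ _) (fun t ht ↦ by
        simpa only [hq _ t ht] using hw (t + p x₀) (by positivity)) rfl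
      rw [Finset.sum_congr rfl fun x _ ↦ hsplit x, Finset.sum_add_distrib, ← Finset.sum_mul,
        ← Finset.sum_filter]
      exact add_nonneg (mul_nonneg (hw 0 le_rfl) hm.le) hqsum

/-- First-order optimality of a constant: it suffices that right derivatives have nonnegative sum
over upper sets and left derivatives have nonpositive sum over lower sets. -/
lemma lossJ_const_le [Fintype X] [PartialOrder X] {ℓ : ℝ → ℝ → ℝ}
    (hconv : ∀ a, ConvexOn ℝ Set.univ (ℓ a)) (g : X → ℝ) (b : ℝ)
    (hU : ∀ U : Finset X, IsUpperFinset U → 0 ≤ ∑ x ∈ U, derivWithin (ℓ (g x)) (Set.Ioi b) b)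
    (hL : ∀ L : Finset X, IsLowerFinset L → ∑ x ∈ L, derivWithin (ℓ (g x)) (Set.Iio b) b ≤ 0)
    (h : X → ℝ) (hh : IsotonicOn h Finset.univ) :
    lossJ ℓ g Finset.univ (fun _ ↦ b) ≤ lossJ ℓ g Finset.univ h := by
  have hmono : ∀ x y, x ≤ y → h x ≤ h y := fun x y ↦ hh x (mem_univ x) y (mem_univ y)
  have hpos : 0 ≤ ∑ x, derivWithin (ℓ (g x)) (Set.Ioi b) b * max (h x - b) 0 := by
    refine sum_mul_nonneg_of_superlevel _ _ (fun x ↦ le_max_right _ _) fun t _ ↦ hU _ ?_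
    intro x hx y hxy
    rw [Finset.mem_filter_univ] at hx ⊢
    exact hx.trans_le (max_le_max_right 0 (sub_le_sub_right (hmono x y hxy) b))
  have hneg : 0 ≤ ∑ x, -derivWithin (ℓ (g x)) (Set.Iio b) b * max (b - h x) 0 := by
    refine sum_mul_nonneg_of_superlevel _ _ (fun x ↦ le_max_right _ _) fun t _ ↦ ?_
    rw [Finset.sum_neg_distrib, neg_nonneg]
    refine hL _ fun y hy x hxy ↦ ?_
    rw [Finset.mem_filter_univ] at hy ⊢
    exact hy.trans_le (max_le_max_right 0 (sub_le_sub_left (hmono x y hxy) b))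
  have hpt : ∀ x, ℓ (g x) b + (derivWithin (ℓ (g x)) (Set.Ioi b) b * max (h x - b) 0 +
      -derivWithin (ℓ (g x)) (Set.Iio b) b * max (b - h x) 0) ≤ ℓ (g x) (h x) := fun x ↦ by
    have hle := (hconv (g x)).leftDeriv_le_rightDeriv_of_mem_interior (x := b) (by simp)
    rcases le_total b (h x) with hb | hb
    · rw [max_eq_left (sub_nonneg.mpr hb), max_eq_right (sub_nonpos.mpr hb)]
      linarith [(hconv (g x)).supporting_slope_of_mem_Icc (Set.right_mem_Icc.mpr hle) (h x)]
    · rw [max_eq_right (sub_nonpos.mpr hb), max_eq_left (sub_nonneg.mpr hb)]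
      linarith [(hconv (g x)).supporting_slope_of_mem_Icc (Set.left_mem_Icc.mpr hle) (h x)]
  have hsum := Finset.sum_le_sum fun x (_ : x ∈ Finset.univ) ↦ hpt x
  rw [Finset.sum_add_distrib, Finset.sum_add_distrib] at hsum
  unfold lossJ
  linarith

/-- If `b ∈ Cf_g(X)` and either `X` is a maximal upper set while `∅`
is a minimal lower set, or `X` is a minimal lower set while `∅` is a maximal upper set
(w.r.t. `b`), then the constant function `b` is isotonic and minimizes `J_X(g, ·)`
over `I_X`. -/
theorem constant_fit_terminal_case_corollary
    [Fintype X] [Nonempty X] [PartialOrder X]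
    (ℓ : ℝ → ℝ → ℝ) (hconv : ∀ a : ℝ, ConvexOn ℝ (Set.univ : Set ℝ) (ℓ a))
    (g : X → ℝ) (b : ℝ)
    (hb : ∀ y : ℝ, ∑ x : X, ℓ (g x) b ≤ ∑ x : X, ℓ (g x) y)
    (hcase : (IsMaxUpper ℓ g b (Finset.univ : Finset X) ∧
                IsMinLower ℓ g b (∅ : Finset X)) ∨
             (IsMinLower ℓ g b (Finset.univ : Finset X) ∧
                IsMaxUpper ℓ g b (∅ : Finset X))) :
    IsotonicOn (fun _ : X => b) Finset.univ ∧
      ∀ h : X → ℝ, IsotonicOn h Finset.univ →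
        lossJ ℓ g Finset.univ (fun _ : X => b) ≤ lossJ ℓ g Finset.univ h := by
  refine ⟨fun _ _ _ _ _ ↦ le_rfl, ?_⟩
  have hmin : ∀ y, (∑ x, ℓ (g x) b) + 0 * (y - b) ≤ ∑ x, ℓ (g x) y := by simpa using hb
  have hright : 0 ≤ ∑ x, derivWithin (ℓ (g x)) (Set.Ioi b) b :=
    supporting_slope_le_rightDeriv hmin <| HasDerivWithinAt.fun_sum fun x _ ↦
      (hconv (g x)).hasDerivWithinAt_rightDeriv_of_mem_interior (by simp)
  have hleft : ∑ x, derivWithin (ℓ (g x)) (Set.Iio b) b ≤ 0 :=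
    leftDeriv_le_supporting_slope hmin <| HasDerivWithinAt.fun_sum fun x _ ↦
      (hconv (g x)).hasDerivWithinAt_leftDeriv_of_mem_interior (by simp)
  simp only [IsMaxUpper, IsMinLower, sInf_SigmaSet hconv, sSup_SigmaSet hconv, neg_le_neg_iff,
    Finset.sum_empty] at hcase
  rcases hcase with ⟨⟨-, hU⟩, -, hL⟩ | ⟨⟨-, hL⟩, -, hU⟩
  · exact lossJ_const_le hconv g b (fun U h ↦ hright.trans (hU U h)) hL
  · exact lossJ_const_le hconv g b hU (fun L h ↦ (hL L h).trans hleft)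
end

section
/- Let b ∈ ℝ, let U be a maximal upper set of X with respect to b, and let U' ⊆ U be any upper set of X. Then min Σ_b(U \ U') ≥ 0. -/
open Pointwise Finset
open scoped Classical

variable {X : Type*}

/-- A finite convex function on the line has a subgradient at every point. -/
theorem subdiff_nonempty {ℓ : ℝ → ℝ → ℝ} {a : ℝ}
    (hconv : ConvexOn ℝ (Set.univ : Set ℝ) (ℓ a)) (b : ℝ) : (subdiff ℓ a b).Nonempty := by
  have slope_le : ∀ y < b, ∀ z > b, (ℓ a b - ℓ a y) / (b - y) ≤ (ℓ a z - ℓ a b) / (z - b) :=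
    fun y hy z hz ↦ hconv.slope_mono_adjacent (Set.mem_univ y) (Set.mem_univ z) hy hz
  let T : Set ℝ := (fun y ↦ (ℓ a b - ℓ a y) / (b - y)) '' Set.Iio b
  have hT : T.Nonempty := Set.nonempty_Iio.image _
  have hbdd : BddAbove T := by
    refine ⟨(ℓ a (b + 1) - ℓ a b) / (b + 1 - b), ?_⟩
    rintro _ ⟨y, hy, rfl⟩
    exact slope_le y hy _ (lt_add_one b)
  refine ⟨sSup T, fun y ↦ ?_⟩
  rcases lt_trichotomy y b with hy | rfl | hy
  · have h := le_csSup hbdd (Set.mem_image_of_mem _ hy)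
    rw [div_le_iff₀ (sub_pos.2 hy)] at h
    linarith
  · simp
  · have h : sSup T ≤ (ℓ a y - ℓ a b) / (y - b) := by
      refine csSup_le hT ?_
      rintro _ ⟨z, hz, rfl⟩
      exact slope_le z hz y hy
    rw [le_div_iff₀ (sub_pos.2 hy)] at h
    linarith

theorem bddAbove_subdiff (ℓ : ℝ → ℝ → ℝ) (a b : ℝ) : BddAbove (subdiff ℓ a b) := by
  refine ⟨ℓ a (b + 1) - ℓ a b, fun s hs ↦ ?_⟩
  have h := hs (b + 1)
  rw [add_sub_cancel_left, mul_one] at h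
  linarith

theorem SigmaSet_nonempty {ℓ : ℝ → ℝ → ℝ}
    (hconv : ∀ a : ℝ, ConvexOn ℝ (Set.univ : Set ℝ) (ℓ a)) (g : X → ℝ) (b : ℝ) (S : Finset X) :
    (SigmaSet ℓ g b S).Nonempty :=
  (Finset.sum_induction _ Set.Nonempty (fun _ _ ↦ Set.Nonempty.add) Set.zero_nonempty
    fun x _ ↦ subdiff_nonempty (hconv (g x)) b).neg

theorem bddBelow_SigmaSet (ℓ : ℝ → ℝ → ℝ) (g : X → ℝ) (b : ℝ) (S : Finset X) :
    BddBelow (SigmaSet ℓ g b S) :=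
  (Finset.sum_induction _ BddAbove (fun _ _ ↦ BddAbove.add) bddAbove_singleton
    fun x _ ↦ bddAbove_subdiff ℓ (g x) b).neg

theorem SigmaSet_sdiff_add [DecidableEq X] (ℓ : ℝ → ℝ → ℝ) (g : X → ℝ) (b : ℝ)
    {S T : Finset X} (h : T ⊆ S) :
    SigmaSet ℓ g b (S \ T) + SigmaSet ℓ g b T = SigmaSet ℓ g b S := by
  rw [SigmaSet, SigmaSet, SigmaSet, ← neg_add, Finset.sum_sdiff h]

theorem sInf_SigmaSet_sdiff_add [DecidableEq X] {ℓ : ℝ → ℝ → ℝ}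
    (hconv : ∀ a : ℝ, ConvexOn ℝ (Set.univ : Set ℝ) (ℓ a)) (g : X → ℝ) (b : ℝ)
    {S T : Finset X} (h : T ⊆ S) :
    sInf (SigmaSet ℓ g b (S \ T)) + sInf (SigmaSet ℓ g b T) = sInf (SigmaSet ℓ g b S) := by
  rw [← SigmaSet_sdiff_add ℓ g b h,
    csInf_add (SigmaSet_nonempty hconv g b _) (bddBelow_SigmaSet ℓ g b _)
      (SigmaSet_nonempty hconv g b _) (bddBelow_SigmaSet ℓ g b _)]

/-- If `U` is a maximal upper set w.r.t. `b` and `U' ⊆ U` is any upper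
set of `X`, then `min Σ_b(U \ U') ≥ 0`. -/
theorem sdiff_of_maximal_upper_nonneg
    [Fintype X] [Nonempty X] [PartialOrder X] [DecidableEq X]
    (ℓ : ℝ → ℝ → ℝ) (hconv : ∀ a : ℝ, ConvexOn ℝ (Set.univ : Set ℝ) (ℓ a))
    (g : X → ℝ) (b : ℝ) (U U' : Finset X)
    (hmax : IsMaxUpper ℓ g b U) (hU' : IsUpperFinset U') (hsub : U' ⊆ U) :
    0 ≤ sInf (SigmaSet ℓ g b (U \ U')) := by
  linarith [hmax.2 U' hU', sInf_SigmaSet_sdiff_add hconv g b hsub]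
end
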